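/- Let G¹ and G² be real symmetric N×N matrices with zero diagonal, and let κ ∈ [0,1). If −λ_min(G²) ≥ (1 + κ·λ_max(G¹))/(1−κ), then λ_min(κ·G¹ + (1−κ)·G²) ≤ −1, and consequently I + κ·G¹ + (1−κ)·G² is not a P-matrix (so the multiplex network game is not guaranteed to have a unique Nash equilibrium). -/

import Mathlib

/-- `M` is a P-matrix: every principal submatrix (obtained by keeping the rows and
columns indexed by a set `s`) has strictly positive determinant. -/
def IsPMatrix {m : Type*} [Fintype m] [DecidableEq m] (M : Matrix m m ℝ) : Prop :=
  ∀ s : Finset m,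
    0 < (M.submatrix (fun i : s => (i : m)) (fun j : s => (j : m))).det

/-- The smallest eigenvalue of a real symmetric (Hermitian) matrix. -/
noncomputable def eigMin {m : Type*} [Fintype m] [DecidableEq m] {A : Matrix m m ℝ}
    (hA : A.IsHermitian) : ℝ := ⨅ i, hA.eigenvalues i

/-- The largest eigenvalue of a real symmetric (Hermitian) matrix. -/
noncomputable def eigMax {m : Type*} [Fintype m] [DecidableEq m] {A : Matrix m m ℝ}
    (hA : A.IsHermitian) : ℝ := ⨆ i, hA.eigenvalues i

open scoped MatrixOrder in
/-- The Rayleigh quotient of a symmetric matrix is bounded below by its smallest eigenvalue. -/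
theorem eigMin_mul_dotProduct_self_le {m : Type*} [Fintype m] [DecidableEq m] {A : Matrix m m ℝ}
    (hA : A.IsHermitian) (x : m → ℝ) :
    eigMin hA * (x ⬝ᵥ x) ≤ x ⬝ᵥ A.mulVec x := by
  have hle : algebraMap ℝ (Matrix m m ℝ) (eigMin hA) ≤ A := by
    rw [algebraMap_le_iff_le_spectrum (ha := hA)]
    intro y hy
    rw [hA.spectrum_real_eq_range_eigenvalues] at hy
    obtain ⟨i, rfl⟩ := hy
    exact ciInf_le (Finite.bddBelow_range _) i
  have := (Matrix.le_iff.mp hle).dotProduct_mulVec_nonneg x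
  simpa [Algebra.algebraMap_eq_smul_one, Matrix.sub_mulVec, Matrix.smul_mulVec,
    dotProduct_sub] using this

open scoped MatrixOrder in
/-- The Rayleigh quotient of a symmetric matrix is bounded above by its largest eigenvalue. -/
theorem dotProduct_mulVec_le_eigMax_mul {m : Type*} [Fintype m] [DecidableEq m]
    {A : Matrix m m ℝ} (hA : A.IsHermitian) (x : m → ℝ) :
    x ⬝ᵥ A.mulVec x ≤ eigMax hA * (x ⬝ᵥ x) := by
  have hle : A ≤ algebraMap ℝ (Matrix m m ℝ) (eigMax hA) := by
    rw [le_algebraMap_iff_spectrum_le (ha := hA)]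
    intro y hy
    rw [hA.spectrum_real_eq_range_eigenvalues] at hy
    obtain ⟨i, rfl⟩ := hy
    exact le_ciSup (Finite.bddAbove_range _) i
  have := (Matrix.le_iff.mp hle).dotProduct_mulVec_nonneg x
  simpa [Algebra.algebraMap_eq_smul_one, Matrix.sub_mulVec, Matrix.smul_mulVec,
    dotProduct_sub] using this

/-- The smallest eigenvalue is attained by an eigenvector. -/
theorem exists_mulVec_eq_eigMin_smul {m : Type*} [Fintype m] [DecidableEq m] [Nonempty m]
    {A : Matrix m m ℝ} (hA : A.IsHermitian) :
    ∃ v : m → ℝ, v ≠ 0 ∧ A.mulVec v = eigMin hA • v := by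
  obtain ⟨i, hi⟩ := exists_eq_ciInf_of_finite (f := hA.eigenvalues)
  refine ⟨(hA.eigenvectorBasis i).ofLp, ?_, ?_⟩
  · simpa using hA.eigenvectorBasis.orthonormal.ne_zero i
  · rw [hA.mulVec_eigenvectorBasis, eigMin, hi]

/-- A determinant in which the rows outside `s` are replaced by those of a diagonal matrix. -/
theorem Matrix.det_piecewise_diagonal {m R : Type*} [Fintype m] [DecidableEq m] [CommRing R]
    (M : Matrix m m R) (d : m → R) (s : Finset m) :
    (Matrix.of fun i j => if i ∈ s then M i j else Matrix.diagonal d i j).det =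
      (M.submatrix (fun i : s => (i : m)) (fun j : s => (j : m))).det *
        ∏ i : {i // i ∉ s}, d i := by
  set A : Matrix m m R := Matrix.of fun i j => if i ∈ s then M i j else Matrix.diagonal d i j
    with hA
  have hin : Matrix.toSquareBlockProp A (· ∈ s) =
      M.submatrix (fun i : s => (i : m)) (fun j : s => (j : m)) := by
    ext i j
    simp [hA, Matrix.toSquareBlockProp]
  have hout : Matrix.toSquareBlockProp A (fun i => i ∉ s) =
      Matrix.diagonal fun i : {i // i ∉ s} => d i := by
    ext i j
    simp [hA, Matrix.toSquareBlockProp, Matrix.diagonal_apply, i.2, Subtype.ext_iff]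
  rw [Matrix.twoBlockTriangular_det A (· ∈ s), hout, Matrix.det_diagonal]
  · rw [← hin]
    congr!
  · intro i hi j hj
    simp [hA, hi, Matrix.diagonal_apply_ne _ (ne_of_mem_of_not_mem hj hi).symm]

/-- Adding a nonnegative diagonal matrix to a P-matrix keeps the determinant positive. -/
theorem IsPMatrix.det_add_diagonal_pos {m : Type*} [Fintype m] [DecidableEq m]
    {M : Matrix m m ℝ} (hM : IsPMatrix M) {d : m → ℝ} (hd : ∀ i, 0 ≤ d i) :
    0 < (M + Matrix.diagonal d).det := by
  have key : (M + Matrix.diagonal d).det =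
      ∑ s : Finset m,
        (Matrix.of fun i j => if i ∈ s then M i j else Matrix.diagonal d i j).det := by
    refine (Matrix.detRowAlternating.toMultilinearMap.map_add_univ M.row
      (Matrix.diagonal d).row).trans (Finset.sum_congr rfl fun s _ => ?_)
    refine congrArg Matrix.det (Matrix.ext fun i j => ?_)
    by_cases hi : i ∈ s <;> simp [Finset.piecewise, hi]
  simp_rw [key, Matrix.det_piecewise_diagonal]
  refine Finset.sum_pos' (fun s _ => ?_) ⟨Finset.univ, Finset.mem_univ _, ?_⟩
  · exact mul_nonneg (hM s).le (Finset.prod_nonneg fun i _ => hd i)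
  · have : IsEmpty {i : m // i ∉ Finset.univ} := ⟨fun i => i.2 (Finset.mem_univ _)⟩
    simpa using hM Finset.univ

/-- For symmetric zero-diagonal layers and `κ ∈ [0,1)`, if
`−λ_min(G²) ≥ (1 + κ·λ_max(G¹))/(1−κ)`, then `λ_min(κ G¹ + (1−κ) G²) ≤ −1` and
`I + κ G¹ + (1−κ) G²` is not a P-matrix (uniqueness of the multiplex NE is not
guaranteed). -/
theorem multiplex_not_pMatrix_of_two_sided_second_layer {N : ℕ}
    (G1 G2 : Matrix (Fin N) (Fin N) ℝ)
    (hG1 : G1.IsHermitian) (hG2 : G2.IsHermitian)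
    (hd1 : ∀ i, G1 i i = 0) (hd2 : ∀ i, G2 i i = 0)
    (κ : ℝ) (hκ : κ ∈ Set.Ico (0 : ℝ) 1)
    (h : -(eigMin hG2) ≥ (1 + κ * eigMax hG1) / (1 - κ))
    (hGp : (κ • G1 + (1 - κ) • G2).IsHermitian) :
    eigMin hGp ≤ -1 ∧ ¬ IsPMatrix (1 + (κ • G1 + (1 - κ) • G2)) := by
  have hκ' : 0 < 1 - κ := sub_pos.mpr hκ.2
  rw [ge_iff_le, div_le_iff₀ hκ'] at h
  have : Nonempty (Fin N) := by
    by_contra hN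
    rw [not_nonempty_iff] at hN
    simp only [eigMin, eigMax, Real.iInf_of_isEmpty, Real.iSup_of_isEmpty] at h
    norm_num at h
  have hmin : eigMin hGp ≤ -1 := by
    obtain ⟨v, hv, hGv⟩ := exists_mulVec_eq_eigMin_smul hG2
    have hpos : 0 < v ⬝ᵥ v :=
      lt_of_le_of_ne (by simpa using dotProduct_star_self_nonneg v)
        (Ne.symm (by simpa using hv))
    have hlow := eigMin_mul_dotProduct_self_le hGp v
    have hup := mul_le_mul_of_nonneg_left (dotProduct_mulVec_le_eigMax_mul hG1 v) hκ.1
    simp only [Matrix.add_mulVec, Matrix.smul_mulVec, hGv, dotProduct_add, dotProduct_smul,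
      smul_eq_mul] at hlow
    refine le_of_mul_le_mul_right ?_ hpos
    linarith [mul_le_mul_of_nonneg_right h hpos.le]
  refine ⟨hmin, fun hP => ?_⟩
  obtain ⟨v, hv, hGv⟩ := exists_mulVec_eq_eigMin_smul hGp
  have hdet := hP.det_add_diagonal_pos (d := fun _ => -1 - eigMin hGp) fun _ => by linarith
  refine hdet.ne' (Matrix.exists_mulVec_eq_zero_iff.mp ⟨v, hv, ?_⟩)
  rw [Matrix.add_mulVec, Matrix.add_mulVec, hGv, Matrix.one_mulVec]
  ext i
  simp only [Pi.add_apply, Pi.smul_apply, Matrix.mulVec_diagonal, smul_eq_mul, Pi.zero_apply]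
  ring
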